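/- arXiv:1604.07718 — 3 statements merged into one kernel-verified Lean document; each statement's English description precedes it below -/
import Mathlib

section
/- Fix b > 0 and define v(x) := −(r/(r+q))·(Zbar(b−x) + m/q) − Zqr(b−x)/φ for x ∈ ℝ. Then v satisfies the Hamilton–Jacobi–Bellman equation of the periodic dividend problem: for every x > 0 and every l ∈ [0, x], (ℒ − q)v(x) + r·( l + v(x−l) − v(x) ) ≤ 0, and equality holds for l = max(x − b, 0). -/
open MeasureTheory Real Set Filter Topology

/-- The Laplace exponent ψ(θ) = γθ + (σ²/2)θ² + ∫_{(0,∞)} (e^{−θz} − 1 + θz·1_{0<z<1}) ν(dz)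
of a spectrally positive Lévy process. -/
noncomputable def levyPsi (γ σ : ℝ) (ν : MeasureTheory.Measure ℝ) (θ : ℝ) : ℝ :=
  γ * θ + σ ^ 2 / 2 * θ ^ 2 +
    ∫ z in Set.Ioi (0:ℝ),
      (Real.exp (-θ * z) - 1 + θ * Set.indicator (Set.Ioo (0:ℝ) 1) id z) ∂ν

/-- The generator (ℒg)(x) = −γg′(x) + (σ²/2)g″(x)
+ ∫_{(0,∞)} (g(x+z) − g(x) − g′(x)·z·1_{0<z<1}) ν(dz). -/
noncomputable def levyGen (γ σ : ℝ) (ν : MeasureTheory.Measure ℝ) (g : ℝ → ℝ) (x : ℝ) : ℝ :=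
  -γ * deriv g x + σ ^ 2 / 2 * deriv (deriv g) x +
    ∫ z in Set.Ioi (0:ℝ),
      (g (x + z) - g x - deriv g x * Set.indicator (Set.Ioo (0:ℝ) 1) id z) ∂ν

/-- `Wbar x = ∫_0^x W(z) dz`. -/
noncomputable def Wbar (W : ℝ → ℝ) (x : ℝ) : ℝ := ∫ z in (0:ℝ)..x, W z

/-- `Zq x = 1 + q · Wbar x`. -/
noncomputable def Zq (q : ℝ) (W : ℝ → ℝ) (x : ℝ) : ℝ := 1 + q * Wbar W x

/-- `Zbar x = ∫_0^x Zq(z) dz`. -/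
noncomputable def Zbar (q : ℝ) (W : ℝ → ℝ) (x : ℝ) : ℝ := ∫ z in (0:ℝ)..x, Zq q W z

/-- `J x = e^{φx} (1 − r ∫_0^x e^{−φz} W(z) dz)`. -/
noncomputable def Jfun (r φ : ℝ) (W : ℝ → ℝ) (x : ℝ) : ℝ :=
  Real.exp (φ * x) * (1 - r * ∫ z in (0:ℝ)..x, Real.exp (-φ * z) * W z)

/-- `Zqr x = (r/(r+q)) Zq x + (q/(r+q)) J x`. -/
noncomputable def Zqr (q r φ : ℝ) (W : ℝ → ℝ) (x : ℝ) : ℝ :=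
  (r / (r + q)) * Zq q W x + (q / (r + q)) * Jfun r φ W x

/-- A continuous function whose Laplace transform vanishes near infinity vanishes on `(0, ∞)`. -/
theorem eq_zero_of_laplace_eq_zero {D : ℝ → ℝ} (hD : Continuous D) {θ₀ : ℝ}
    (hint : ∀ θ > θ₀, IntegrableOn (fun y => exp (-θ * y) * D y) (Ioi 0))
    (h0 : ∀ θ > θ₀, ∫ y in Ioi (0 : ℝ), exp (-θ * y) * D y = 0) :
    ∀ y > 0, D y = 0 := by
  set w : ℝ → ℝ := fun y => exp (-(θ₀ + 1) * y) * D y with hw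
  have hwc : Continuous w := by fun_prop
  have hwint : IntegrableOn w (Ioi 0) := hint _ (by linarith)
  have hpoly : ∀ p : Polynomial ℝ, IntegrableOn (fun y => p.eval (exp (-y)) * w y) (Ioi 0) ∧
      ∫ y in Ioi (0 : ℝ), p.eval (exp (-y)) * w y = 0 := by
    intro p
    induction p using Polynomial.induction_on' with
    | add p s hp hs =>
      simp only [Polynomial.eval_add, add_mul]
      refine ⟨hp.1.add hs.1, ?_⟩
      rw [integral_add hp.1 hs.1, hp.2, hs.2, add_zero]
    | monomial n a =>
      have hθ : θ₀ + 1 + n > θ₀ := by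
        have : (0 : ℝ) ≤ n := n.cast_nonneg
        linarith
      have key : (fun y => (Polynomial.monomial n a).eval (exp (-y)) * w y) =
          fun y => a * (exp (-(θ₀ + 1 + n) * y) * D y) := by
        ext y
        rw [Polynomial.eval_monomial, hw, ← Real.exp_nat_mul]
        have : exp (-(θ₀ + 1 + n) * y) = exp (n * -y) * exp (-(θ₀ + 1) * y) := by
          rw [← Real.exp_add]; ring_nf
        rw [this]; ring
      rw [key]
      refine ⟨(hint _ hθ).const_mul a, ?_⟩
      rw [integral_const_mul, h0 _ hθ, mul_zero]
  have htest : ∀ g : ℝ → ℝ, Continuous g → HasCompactSupport g →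
      ∫ y in Ioi (0 : ℝ), g y * w y = 0 := by
    intro g hg hgs
    obtain ⟨R, hR⟩ := hgs.isCompact.isBounded.subset_closedBall 0
    have hgR : ∀ y, R < y → g y = 0 := by
      intro y hy
      by_contra hne
      have := hR (subset_tsupport g hne)
      rw [Metric.mem_closedBall, Real.dist_eq, sub_zero] at this
      linarith [le_abs_self y]
    let G : ℝ → ℝ := fun s => if s ≤ 0 then 0 else g (-log s)
    have hG : ContinuousOn G (Icc 0 1) := by
      refine Continuous.continuousOn (continuous_iff_continuousAt.2 fun s => ?_)
      rcases lt_or_ge 0 s with hs | hs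
      · have : G =ᶠ[𝓝 s] fun s => g (-log s) := by
          filter_upwards [lt_mem_nhds hs] with t ht
          simp [G, not_le.2 ht]
        refine ContinuousAt.congr ?_ this.symm
        exact hg.continuousAt.comp (continuousAt_log hs.ne').neg
      · have : G =ᶠ[𝓝 s] fun _ => 0 := by
          filter_upwards [gt_mem_nhds (hs.trans_lt (exp_pos (-R)))] with t ht
          by_cases h : t ≤ 0
          · simp [G, h]
          · simp only [G, h, if_false]
            apply hgR
            have := (Real.log_lt_iff_lt_exp (not_le.1 h)).2 ht
            linarith
        exact continuousAt_const.congr this.symm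
    have hGe : ∀ y, G (exp (-y)) = g y := by
      intro y
      simp [G, not_le.2 (exp_pos (-y))]
    have hgint : IntegrableOn (fun y => g y * w y) (Ioi 0) := by
      obtain ⟨C, hC⟩ := hgs.exists_bound_of_continuous hg
      exact hwint.bdd_mul (c := C) hg.aestronglyMeasurable (Eventually.of_forall hC)
    have hε : ∀ ε > 0, |∫ y in Ioi (0 : ℝ), g y * w y| ≤ ε * ∫ y in Ioi (0 : ℝ), |w y| := by
      intro ε hε
      obtain ⟨p, hp⟩ := exists_polynomial_near_of_continuousOn 0 1 G hG ε hε
      have h1 : ∫ y in Ioi (0 : ℝ), g y * w y =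
          ∫ y in Ioi (0 : ℝ), (g y * w y - p.eval (exp (-y)) * w y) := by
        rw [integral_sub hgint (hpoly p).1, (hpoly p).2, sub_zero]
      rw [h1, ← integral_const_mul, ← Real.norm_eq_abs]
      refine norm_integral_le_of_norm_le (hwint.abs.const_mul ε) ?_
      filter_upwards [ae_restrict_mem measurableSet_Ioi] with y hy
      rw [← sub_mul, norm_mul, Real.norm_eq_abs, Real.norm_eq_abs, ← hGe, abs_sub_comm]
      refine mul_le_mul_of_nonneg_right (hp _ ⟨(exp_pos _).le, ?_⟩).le (abs_nonneg _)
      exact Real.exp_le_one_iff.2 (neg_nonpos.2 (le_of_lt hy))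
    have hlim : Tendsto (fun ε : ℝ => ε * ∫ y in Ioi (0 : ℝ), |w y|) (𝓝[>] 0) (𝓝 0) := by
      have : Tendsto (fun ε : ℝ => ε * ∫ y in Ioi (0 : ℝ), |w y|) (𝓝 0)
          (𝓝 (0 * ∫ y in Ioi (0 : ℝ), |w y|)) := tendsto_id.mul_const _
      rw [zero_mul] at this
      exact this.mono_left nhdsWithin_le_nhds
    have := ge_of_tendsto hlim (eventually_mem_nhdsWithin.mono fun ε h => hε ε h)
    exact abs_nonpos_iff.1 this
  have hae : ∀ᵐ y, y ∈ Ioi (0 : ℝ) → w y = 0 := by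
    refine isOpen_Ioi.ae_eq_zero_of_integral_contDiff_smul_eq_zero
      hwint.locallyIntegrableOn fun g hg hgs hgt => ?_
    rw [← htest g hg.continuous hgs]
    refine (setIntegral_eq_integral_of_forall_compl_eq_zero fun y hy => ?_).symm
    rw [image_eq_zero_of_notMem_tsupport fun h => hy (hgt h), zero_smul]
  have heq : EqOn w (fun _ => 0) (Ioi 0) :=
    Measure.eqOn_open_of_ae_eq ((ae_restrict_iff' measurableSet_Ioi).2 hae) isOpen_Ioi
      hwc.continuousOn continuousOn_const
  intro y hy
  have := heq hy
  simpa [hw, (exp_pos _).ne'] using this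

theorem sFinite_of_integrable_pos {α : Type*} [MeasurableSpace α] {μ : Measure α} {f : α → ℝ}
    (hfm : Measurable f) (hf : Integrable f μ) (hpos : ∀ᵐ x ∂μ, 0 < f x) : SFinite μ := by
  have hfin : IsFiniteMeasure (μ.withDensity fun x => ENNReal.ofReal (f x)) :=
    isFiniteMeasure_withDensity_ofReal hf.2
  rw [← withDensity_inv_same (μ := μ) (f := fun x => ENNReal.ofReal (f x)) hfm.ennreal_ofReal
    (hpos.mono fun x hx => (ENNReal.ofReal_pos.2 hx).ne')
    (Eventually.of_forall fun x => ENNReal.ofReal_ne_top)]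
  infer_instance

theorem min_one_sq_pos {z : ℝ} (hz : 0 < z) : 0 < min 1 (z ^ 2) :=
  lt_min one_pos (by positivity)

theorem sFinite_restrict_Ioi {ν : Measure ℝ}
    (hν : IntegrableOn (fun z => min 1 (z ^ 2)) (Ioi 0) ν) : SFinite (ν.restrict (Ioi 0)) :=
  sFinite_of_integrable_pos (by fun_prop) hν
    ((ae_restrict_mem measurableSet_Ioi).mono fun _ hz => min_one_sq_pos hz)

theorem measurable_indicator_Ioo_id : Measurable (indicator (Ioo (0 : ℝ) 1) id) :=
  measurable_id.indicator measurableSet_Ioo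

theorem integrableOn_exp_compensated {ν : Measure ℝ}
    (hν : IntegrableOn (fun z => min 1 (z ^ 2)) (Ioi 0) ν) {θ : ℝ} (hθ : 0 < θ) :
    IntegrableOn (fun z => exp (-θ * z) - 1 + θ * indicator (Ioo (0 : ℝ) 1) id z) (Ioi 0) ν := by
  refine Integrable.mono' (hν.const_mul (1 + θ ^ 2)) ?_ ?_
  · have := measurable_indicator_Ioo_id
    exact Measurable.aestronglyMeasurable (by fun_prop)
  · filter_upwards [ae_restrict_mem measurableSet_Ioi] with z hz
    have hz : 0 < z := hz
    have hθz : 0 < θ * z := mul_pos hθ hz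
    have hlow := Real.add_one_le_exp (-θ * z)
    have he1 : exp (-θ * z) ≤ 1 := Real.exp_le_one_iff.2 (by nlinarith)
    have he0 := exp_pos (-θ * z)
    rw [Real.norm_eq_abs, abs_le]
    rcases lt_or_ge z 1 with h1 | h1
    · rw [indicator_of_mem (show z ∈ Ioo (0 : ℝ) 1 from ⟨hz, h1⟩), id,
        min_eq_right (by nlinarith)]
      have hup : exp (-θ * z) * (1 + θ * z) ≤ 1 := by
        have h2 := Real.add_one_le_exp (θ * z)
        have h3 : exp (-θ * z) * exp (θ * z) = 1 := by
          rw [← Real.exp_add]; simp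
        nlinarith
      have hsq : 0 ≤ (1 + θ ^ 2) * z ^ 2 := by positivity
      constructor
      · nlinarith
      · nlinarith [mul_pos he0 hθz, mul_nonneg hθz.le (sub_nonneg.2 he1),
          mul_nonneg hθz.le (sub_nonneg.2 hlow)]
    · rw [indicator_of_notMem (fun h : z ∈ Ioo (0 : ℝ) 1 => absurd h.2 (not_lt.2 h1)),
        min_eq_left (by nlinarith)]
      constructor <;> nlinarith [sq_nonneg θ]

/-- A convex twice differentiable function `u` which vanishes on `(-∞, 0]`, with first derivative
`u₁` and nondecreasing continuous second derivative `u₂`. -/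
structure IsMonotoneSmooth (u u₁ u₂ : ℝ → ℝ) : Prop where
  hasDerivAt : ∀ y, HasDerivAt u (u₁ y) y
  hasDerivAt' : ∀ y, HasDerivAt u₁ (u₂ y) y
  continuous_second : Continuous u₂
  monotone_second : Monotone u₂
  eq_zero : ∀ y ≤ 0, u y = 0
  eq_zero' : ∀ y ≤ 0, u₁ y = 0
  eq_zero'' : ∀ y ≤ 0, u₂ y = 0

namespace IsMonotoneSmooth

variable {u u₁ u₂ : ℝ → ℝ}

theorem nonneg_of_monotone {f : ℝ → ℝ} (hf : Monotone f) (h0 : ∀ y ≤ 0, f y = 0) (y : ℝ) :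
    0 ≤ f y := by
  rcases le_total y 0 with h | h
  · exact (h0 y h).ge
  · exact (h0 0 le_rfl).ge.trans (hf h)

theorem second_nonneg (h : IsMonotoneSmooth u u₁ u₂) (y : ℝ) : 0 ≤ u₂ y :=
  nonneg_of_monotone h.monotone_second h.eq_zero'' y

theorem first_monotone (h : IsMonotoneSmooth u u₁ u₂) : Monotone u₁ :=
  monotone_of_hasDerivAt_nonneg h.hasDerivAt' h.second_nonneg

theorem first_nonneg (h : IsMonotoneSmooth u u₁ u₂) (y : ℝ) : 0 ≤ u₁ y :=
  nonneg_of_monotone h.first_monotone h.eq_zero' y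

theorem monotone (h : IsMonotoneSmooth u u₁ u₂) : Monotone u :=
  monotone_of_hasDerivAt_nonneg h.hasDerivAt h.first_nonneg

theorem nonneg (h : IsMonotoneSmooth u u₁ u₂) (y : ℝ) : 0 ≤ u y :=
  nonneg_of_monotone h.monotone h.eq_zero y

theorem continuous (h : IsMonotoneSmooth u u₁ u₂) : Continuous u :=
  continuous_iff_continuousAt.2 fun y => (h.hasDerivAt y).continuousAt

theorem continuous_first (h : IsMonotoneSmooth u u₁ u₂) : Continuous u₁ :=
  continuous_iff_continuousAt.2 fun y => (h.hasDerivAt' y).continuousAt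

/-- The compensated jump increment is dominated by `min 1 z²`. -/
theorem abs_jump_le (h : IsMonotoneSmooth u u₁ u₂) (y : ℝ) {z : ℝ} (hz : 0 < z) :
    |u (y - z) - u y + u₁ y * indicator (Ioo (0 : ℝ) 1) id z| ≤
      (u₂ y + u y) * min 1 (z ^ 2) := by
  have hu := h.nonneg y
  have hu2 := h.second_nonneg y
  rcases lt_or_ge z 1 with h1 | h1
  · rw [indicator_of_mem (show z ∈ Ioo (0 : ℝ) 1 from ⟨hz, h1⟩), id, min_eq_right (by nlinarith)]
    obtain ⟨c, ⟨hc1, hc2⟩, hc⟩ := exists_hasDerivAt_eq_slope u u₁ (show y - z < y by linarith)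
      h.continuous.continuousOn fun x _ => h.hasDerivAt x
    obtain ⟨d, ⟨hd1, hd2⟩, hd⟩ := exists_hasDerivAt_eq_slope u₁ u₂ hc2
      h.continuous_first.continuousOn fun x _ => h.hasDerivAt' x
    rw [eq_div_iff (by linarith)] at hc hd
    have hd0 := h.second_nonneg d
    have hdy := h.monotone_second hd2.le
    have key : u (y - z) - u y + u₁ y * z = u₂ d * (y - c) * z := by
      rw [hd]; linear_combination hc
    rw [key, abs_of_nonneg (mul_nonneg (mul_nonneg hd0 (by linarith)) hz.le)]
    have : u₂ d * (y - c) ≤ u₂ y * z := mul_le_mul hdy (by linarith) (by linarith) hu2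
    nlinarith [mul_nonneg hu (sq_nonneg z)]
  · rw [indicator_of_notMem (fun h : z ∈ Ioo (0 : ℝ) 1 => absurd h.2 (not_lt.2 h1)),
      min_eq_left (by nlinarith)]
    have h2 := h.nonneg (y - z)
    have h3 := h.monotone (show y - z ≤ y by linarith)
    rw [abs_le]
    constructor <;> linarith

theorem measurable_jump (h : IsMonotoneSmooth u u₁ u₂) : Measurable fun p : ℝ × ℝ =>
    u (p.1 - p.2) - u p.1 + u₁ p.1 * indicator (Ioo (0 : ℝ) 1) id p.2 := by
  have h1 := h.continuous.measurable
  have h2 := h.continuous_first.measurable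
  have h3 : Measurable fun p : ℝ × ℝ => indicator (Ioo (0 : ℝ) 1) id p.2 :=
    measurable_indicator_Ioo_id.comp measurable_snd
  exact ((h1.comp (measurable_fst.sub measurable_snd)).sub (h1.comp measurable_fst)).add
    ((h2.comp measurable_fst).mul h3)

theorem integrableOn_jump (h : IsMonotoneSmooth u u₁ u₂) {ν : Measure ℝ}
    (hν : IntegrableOn (fun z => min 1 (z ^ 2)) (Ioi 0) ν) (y : ℝ) :
    IntegrableOn (fun z => u (y - z) - u y + u₁ y * indicator (Ioo (0 : ℝ) 1) id z) (Ioi 0) ν := by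
  refine Integrable.mono' (hν.const_mul (u₂ y + u y)) ?_ ?_
  · exact (h.measurable_jump.comp measurable_prodMk_left).aestronglyMeasurable
  · filter_upwards [ae_restrict_mem measurableSet_Ioi] with z hz
    exact h.abs_jump_le y hz

theorem continuous_integral_jump (h : IsMonotoneSmooth u u₁ u₂) {ν : Measure ℝ}
    (hν : IntegrableOn (fun z => min 1 (z ^ 2)) (Ioi 0) ν) :
    Continuous fun y => ∫ z in Ioi (0 : ℝ),
      (u (y - z) - u y + u₁ y * indicator (Ioo (0 : ℝ) 1) id z) ∂ν := by
  refine continuous_iff_continuousAt.2 fun y₀ => ?_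
  refine continuousAt_of_dominated
    (bound := fun z => (u₂ (y₀ + 1) + u (y₀ + 1)) * min 1 (z ^ 2)) ?_ ?_ (hν.const_mul _) ?_
  · exact Eventually.of_forall fun y =>
      (h.measurable_jump.comp measurable_prodMk_left).aestronglyMeasurable
  · filter_upwards [gt_mem_nhds (show y₀ < y₀ + 1 by linarith)] with y hy
    filter_upwards [ae_restrict_mem measurableSet_Ioi] with z hz
    refine (h.abs_jump_le y hz).trans (mul_le_mul_of_nonneg_right ?_ (min_one_sq_pos hz).le)
    exact add_le_add (h.monotone_second hy.le) (h.monotone hy.le)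
  · refine Eventually.of_forall fun z => Continuous.continuousAt ?_
    have h1 := h.continuous
    have h2 := h.continuous_first
    fun_prop

theorem laplace_shift {θ U : ℝ} (h : ∀ y ≤ 0, u y = 0)
    (hi : IntegrableOn (fun y => exp (-θ * y) * u y) (Ioi 0))
    (hU : ∫ y in Ioi (0 : ℝ), exp (-θ * y) * u y = U) {z : ℝ} (hz : 0 < z) :
    IntegrableOn (fun y => exp (-θ * y) * u (y - z)) (Ioi 0) ∧
      ∫ y in Ioi (0 : ℝ), exp (-θ * y) * u (y - z) = exp (-θ * z) * U := by
  have hi' : Integrable (fun y => exp (-θ * y) * u y) := by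
    refine (integrableOn_iff_integrable_of_support_subset fun y hy => ?_).1 hi
    by_contra hn
    exact hy (by simp [h y (not_lt.1 hn)])
  have hU' : ∫ y, exp (-θ * y) * u y = U := by
    rw [← hU]
    refine (setIntegral_eq_integral_of_forall_compl_eq_zero fun y hy => ?_).symm
    simp [h y (not_lt.1 hy)]
  have heq : (fun y => exp (-θ * y) * u (y - z)) =
      fun y => exp (-θ * z) * (exp (-θ * (y - z)) * u (y - z)) := by
    ext y
    rw [← mul_assoc, ← Real.exp_add]
    ring_nf
  constructor
  · rw [heq]
    exact ((hi'.comp_sub_right z).const_mul _).integrableOn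
  · rw [setIntegral_eq_integral_of_forall_compl_eq_zero, heq, integral_const_mul,
      integral_sub_right_eq_self (fun y => exp (-θ * y) * u y), hU']
    intro y hy
    have : y ≤ 0 := not_lt.1 hy
    simp [h (y - z) (by linarith)]

/-- The Laplace transform of the jump part of the generator. -/
theorem laplace_integral_jump (h : IsMonotoneSmooth u u₁ u₂) {ν : Measure ℝ}
    (hν : IntegrableOn (fun z => min 1 (z ^ 2)) (Ioi 0) ν) {θ U : ℝ}
    (hi : IntegrableOn (fun y => exp (-θ * y) * u y) (Ioi 0))
    (hi₁ : IntegrableOn (fun y => exp (-θ * y) * u₁ y) (Ioi 0))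
    (hi₂ : IntegrableOn (fun y => exp (-θ * y) * u₂ y) (Ioi 0))
    (hU : ∫ y in Ioi (0 : ℝ), exp (-θ * y) * u y = U)
    (hU₁ : ∫ y in Ioi (0 : ℝ), exp (-θ * y) * u₁ y = θ * U) :
    IntegrableOn (fun y => exp (-θ * y) * ∫ z in Ioi (0 : ℝ),
      (u (y - z) - u y + u₁ y * indicator (Ioo (0 : ℝ) 1) id z) ∂ν) (Ioi 0) ∧
    ∫ y in Ioi (0 : ℝ), exp (-θ * y) * ∫ z in Ioi (0 : ℝ),
      (u (y - z) - u y + u₁ y * indicator (Ioo (0 : ℝ) 1) id z) ∂ν =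
    U * ∫ z in Ioi (0 : ℝ),
      (exp (-θ * z) - 1 + θ * indicator (Ioo (0 : ℝ) 1) id z) ∂ν := by
  have := sFinite_restrict_Ioi hν
  have hK : Integrable (Function.uncurry fun y z => exp (-θ * y) *
      (u (y - z) - u y + u₁ y * indicator (Ioo (0 : ℝ) 1) id z))
      ((volume.restrict (Ioi 0)).prod (ν.restrict (Ioi 0))) := by
    refine Integrable.mono' ((hi₂.add hi).mul_prod hν) ?_ ?_
    · refine Measurable.aestronglyMeasurable (Measurable.mul ?_ h.measurable_jump)
      fun_prop
    · filter_upwards [Measure.quasiMeasurePreserving_snd.ae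
        (ae_restrict_mem measurableSet_Ioi)] with p hp
      have := mul_le_mul_of_nonneg_left (h.abs_jump_le p.1 hp) (exp_pos (-θ * p.1)).le
      simp only [Function.uncurry, norm_mul, Real.norm_eq_abs, abs_of_pos (exp_pos _),
        Pi.add_apply]
      linarith
  constructor
  · have := hK.integral_prod_left
    simp only [Function.uncurry, integral_const_mul] at this
    exact this
  · simp_rw [← integral_const_mul]
    rw [integral_integral_swap hK]
    refine setIntegral_congr_fun measurableSet_Ioi fun z hz => ?_
    obtain ⟨hs, hs'⟩ := laplace_shift h.eq_zero hi hU hz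
    have : ∀ y, exp (-θ * y) * (u (y - z) - u y + u₁ y * indicator (Ioo (0 : ℝ) 1) id z) =
        exp (-θ * y) * u (y - z) - exp (-θ * y) * u y +
          exp (-θ * y) * u₁ y * indicator (Ioo (0 : ℝ) 1) id z := fun y => by ring
    have hsub : IntegrableOn (fun y => exp (-θ * y) * u (y - z) - exp (-θ * y) * u y) (Ioi 0) :=
      hs.sub hi
    simp_rw [this]
    rw [integral_add hsub (hi₁.mul_const _), integral_sub hs hi, integral_mul_const,
      hs', hU, hU₁]
    ring

end IsMonotoneSmooth

theorem laplace_primitive {f : ℝ → ℝ} {θ F : ℝ} (hθ : 0 < θ)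
    (hi : IntegrableOn (fun y => exp (-θ * y) * f y) (Ioi 0))
    (hF : ∫ y in Ioi (0 : ℝ), exp (-θ * y) * f y = F) :
    IntegrableOn (fun y => exp (-θ * y) * ∫ t in (0 : ℝ)..y, f t) (Ioi 0) ∧
      ∫ y in Ioi (0 : ℝ), exp (-θ * y) * ∫ t in (0 : ℝ)..y, f t = F / θ := by
  have he : IntegrableOn (fun y => exp (-θ * y)) (Ioi 0) := exp_neg_integrableOn_Ioi 0 hθ
  have hint := integrable_posConvolution hi he (ContinuousLinearMap.mul ℝ ℝ)
  have hval := integral_posConvolution hi he (ContinuousLinearMap.mul ℝ ℝ)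
  have hconv : ∀ y, ∫ t in (0 : ℝ)..y, (ContinuousLinearMap.mul ℝ ℝ) (exp (-θ * t) * f t)
      (exp (-θ * (y - t))) = exp (-θ * y) * ∫ t in (0 : ℝ)..y, f t := by
    intro y
    rw [← intervalIntegral.integral_const_mul]
    refine intervalIntegral.integral_congr fun t _ => ?_
    have : exp (-θ * y) = exp (-θ * t) * exp (-θ * (y - t)) := by
      rw [← Real.exp_add]; ring_nf
    simp only [ContinuousLinearMap.mul_apply']
    rw [this]; ring
  constructor
  · have h2 := hint.integrableOn (s := Ioi 0)
    refine h2.congr_fun (fun y hy => ?_) measurableSet_Ioi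
    rw [posConvolution, indicator_of_mem hy, hconv]
  · simp_rw [hconv] at hval
    rw [hval, hF, ContinuousLinearMap.mul_apply', integral_exp_mul_Ioi (by linarith)]
    rw [mul_zero, Real.exp_zero, neg_div_neg_eq, mul_one_div]

/-- The exponentially weighted potential `e^{φy} ∫_0^y e^{-φz} W(z) dz`. -/
noncomputable def expConv (φ : ℝ) (W : ℝ → ℝ) (y : ℝ) : ℝ :=
  exp (φ * y) * ∫ z in (0 : ℝ)..y, exp (-φ * z) * W z

/-- The convolution of `W` with `y ↦ (e^{φy} - 1) / φ - y`. -/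
noncomputable def potential (φ : ℝ) (W : ℝ → ℝ) (y : ℝ) : ℝ :=
  (expConv φ W y - Wbar W y) / φ - ∫ z in (0 : ℝ)..y, Wbar W z

/-- A nonnegative function vanishing on the negative half-line, continuous on the positive
half-line, with finite Laplace transform at `φ`. -/
structure HasLaplaceAt (φ : ℝ) (W : ℝ → ℝ) : Prop where
  eq_zero : ∀ x < 0, W x = 0
  nonneg : ∀ x, 0 ≤ W x
  continuousOn : ContinuousOn W (Ioi 0)
  integrableOn : IntegrableOn (fun z => exp (-φ * z) * W z) (Ioi 0)

theorem hasDerivAt_primitive_of_ne {f : ℝ → ℝ} (hf : ContinuousOn f {0}ᶜ)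
    (hi : ∀ a b, IntervalIntegrable f volume a b) {y : ℝ} (hy : y ≠ 0) :
    HasDerivAt (fun y => ∫ t in (0 : ℝ)..y, f t) (f y) y :=
  intervalIntegral.integral_hasDerivAt_right (hi 0 y)
    (hf.stronglyMeasurableAtFilter isOpen_compl_singleton y hy)
    (hf.continuousAt (isOpen_compl_singleton.mem_nhds hy))

theorem primitive_eq_zero_of_nonpos {f : ℝ → ℝ} (hf : ∀ x < 0, f x = 0) {y : ℝ} (hy : y ≤ 0) :
    ∫ t in (0 : ℝ)..y, f t = 0 := by
  rw [intervalIntegral.integral_of_ge hy, integral_Ioc_eq_integral_Ioo,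
    setIntegral_congr_fun (g := fun _ => (0 : ℝ)) measurableSet_Ioo fun x hx => hf x hx.2]
  simp

namespace HasLaplaceAt

variable {φ : ℝ} {W : ℝ → ℝ}

theorem continuousOn_compl (h : HasLaplaceAt φ W) : ContinuousOn W {0}ᶜ := by
  intro x hx
  refine ContinuousAt.continuousWithinAt ?_
  rcases lt_or_gt_of_ne hx with hx | hx
  · refine continuousAt_const.congr (f := fun _ => (0 : ℝ)) ?_
    filter_upwards [gt_mem_nhds hx] with t ht
    rw [h.eq_zero t ht]
  · exact h.continuousOn.continuousAt (isOpen_Ioi.mem_nhds hx)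

theorem intervalIntegrable_exp (h : HasLaplaceAt φ W) (a b : ℝ) :
    IntervalIntegrable (fun z => exp (-φ * z) * W z) volume a b := by
  have h1 : IntegrableOn (fun z => exp (-φ * z) * W z) (Ici 0) :=
    (integrableOn_Ici_iff_integrableOn_Ioi (by simp)).2 h.integrableOn
  have h2 : Integrable (fun z => exp (-φ * z) * W z) := by
    refine (integrableOn_iff_integrable_of_support_subset fun y hy => ?_).1 h1
    by_contra hn
    exact hy (by simp [h.eq_zero y (not_le.1 hn)])
  exact h2.intervalIntegrable

theorem intervalIntegrable (h : HasLaplaceAt φ W) (a b : ℝ) :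
    IntervalIntegrable W volume a b := by
  have h1 := (h.intervalIntegrable_exp a b).continuousOn_mul
    (g := fun z => exp (φ * z)) (by fun_prop)
  refine h1.congr fun z _ => ?_
  rw [← mul_assoc, ← Real.exp_add]
  simp

theorem continuous_Wbar (h : HasLaplaceAt φ W) : Continuous (Wbar W) :=
  intervalIntegral.continuous_primitive h.intervalIntegrable 0

theorem continuous_expConv (h : HasLaplaceAt φ W) : Continuous (expConv φ W) := by
  have := intervalIntegral.continuous_primitive h.intervalIntegrable_exp 0
  unfold expConv
  fun_prop

theorem Wbar_eq_zero (h : HasLaplaceAt φ W) {y : ℝ} (hy : y ≤ 0) : Wbar W y = 0 :=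
  primitive_eq_zero_of_nonpos h.eq_zero hy

theorem expConv_eq_zero (h : HasLaplaceAt φ W) {y : ℝ} (hy : y ≤ 0) : expConv φ W y = 0 := by
  rw [expConv, primitive_eq_zero_of_nonpos (fun x hx => by rw [h.eq_zero x hx, mul_zero]) hy,
    mul_zero]

theorem hasDerivAt_expConv_sub_Wbar (h : HasLaplaceAt φ W) (y : ℝ) :
    HasDerivAt (fun y => expConv φ W y - Wbar W y) (φ * expConv φ W y) y := by
  refine hasDerivAt_of_hasDerivAt_of_ne' (x := 0) (g := fun y => φ * expConv φ W y)
    (fun y hy => ?_) (h.continuous_expConv.sub h.continuous_Wbar).continuousAt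
    (h.continuous_expConv.const_mul φ).continuousAt y
  have h1 := hasDerivAt_primitive_of_ne h.continuousOn_compl h.intervalIntegrable hy
  have h2 := hasDerivAt_primitive_of_ne (f := fun z => exp (-φ * z) * W z)
    ((by fun_prop : Continuous fun z => exp (-φ * z)).continuousOn.mul h.continuousOn_compl)
    h.intervalIntegrable_exp hy
  have h3 : HasDerivAt (fun y => exp (φ * y)) (exp (φ * y) * (φ * 1)) y :=
    ((hasDerivAt_id y).const_mul φ).exp
  refine ((h3.mul h2).sub h1).congr_deriv ?_
  have h4 : exp (φ * y) * (exp (-φ * y) * W y) = W y := by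
    rw [← mul_assoc, ← Real.exp_add]; simp
  rw [h4, expConv]
  ring

theorem primitive_monotone (h : HasLaplaceAt φ W) :
    Monotone fun y => ∫ z in (0 : ℝ)..y, exp (-φ * z) * W z := by
  intro x y hxy
  rw [← sub_nonneg, intervalIntegral.integral_interval_sub_left (h.intervalIntegrable_exp _ _)
    (h.intervalIntegrable_exp _ _)]
  exact intervalIntegral.integral_nonneg hxy fun z _ => mul_nonneg (exp_pos _).le (h.nonneg z)

theorem monotone_expConv (h : HasLaplaceAt φ W) (hφ : 0 < φ) : Monotone (expConv φ W) := by
  intro x y hxy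
  have h0 : 0 ≤ ∫ z in (0 : ℝ)..x, exp (-φ * z) * W z :=
    IsMonotoneSmooth.nonneg_of_monotone h.primitive_monotone (fun y hy =>
      primitive_eq_zero_of_nonpos (fun x hx => by rw [h.eq_zero x hx, mul_zero]) hy) x
  exact mul_le_mul (Real.exp_le_exp.2 (by nlinarith)) (h.primitive_monotone hxy) h0 (exp_pos _).le

theorem expConv_le (h : HasLaplaceAt φ W) (y : ℝ) :
    expConv φ W y ≤ exp (φ * y) * ∫ z in Ioi (0 : ℝ), exp (-φ * z) * W z := by
  have hnn : ∀ z, 0 ≤ exp (-φ * z) * W z := fun z => mul_nonneg (exp_pos _).le (h.nonneg z)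
  rcases le_total y 0 with hy | hy
  · rw [h.expConv_eq_zero hy]
    exact mul_nonneg (exp_pos _).le (integral_nonneg hnn)
  · refine mul_le_mul_of_nonneg_left ?_ (exp_pos _).le
    rw [intervalIntegral.integral_of_le hy]
    exact setIntegral_mono_set h.integrableOn (Eventually.of_forall hnn)
      Ioc_subset_Ioi_self.eventuallyLE

theorem isMonotoneSmooth_potential (h : HasLaplaceAt φ W) (hφ : 0 < φ) :
    IsMonotoneSmooth (potential φ W) (fun y => expConv φ W y - Wbar W y)
      (fun y => φ * expConv φ W y) where
  hasDerivAt y := by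
    have h1 := intervalIntegral.integral_hasDerivAt_right
      (h.continuous_Wbar.intervalIntegrable 0 y)
      (h.continuous_Wbar.stronglyMeasurableAtFilter _ _) h.continuous_Wbar.continuousAt
    refine (((h.hasDerivAt_expConv_sub_Wbar y).div_const φ).sub h1).congr_deriv ?_
    field_simp
  hasDerivAt' := h.hasDerivAt_expConv_sub_Wbar
  continuous_second := h.continuous_expConv.const_mul φ
  monotone_second := (h.monotone_expConv hφ).const_mul hφ.le
  eq_zero y hy := by
    rw [potential, h.expConv_eq_zero hy, h.Wbar_eq_zero hy,
      primitive_eq_zero_of_nonpos (fun x hx => h.Wbar_eq_zero hx.le) hy]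
    simp
  eq_zero' y hy := by rw [h.expConv_eq_zero hy, h.Wbar_eq_zero hy, sub_zero]
  eq_zero'' y hy := by rw [h.expConv_eq_zero hy, mul_zero]

end HasLaplaceAt

theorem laplace_expConv {φ θ w : ℝ} {W : ℝ → ℝ} (hθ : φ < θ)
    (hi : IntegrableOn (fun y => exp (-θ * y) * W y) (Ioi 0))
    (hw : ∫ y in Ioi (0 : ℝ), exp (-θ * y) * W y = w) :
    IntegrableOn (fun y => exp (-θ * y) * expConv φ W y) (Ioi 0) ∧
      ∫ y in Ioi (0 : ℝ), exp (-θ * y) * expConv φ W y = w / (θ - φ) := by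
  have h1 : (fun y => exp (-(θ - φ) * y) * (exp (-φ * y) * W y)) =
      fun y => exp (-θ * y) * W y := by
    ext y
    rw [← mul_assoc, ← Real.exp_add]; ring_nf
  have h2 : (fun y => exp (-(θ - φ) * y) * ∫ z in (0 : ℝ)..y, exp (-φ * z) * W z) =
      fun y => exp (-θ * y) * expConv φ W y := by
    ext y
    rw [expConv, ← mul_assoc, ← Real.exp_add]; ring_nf
  have h3 := laplace_primitive (f := fun y => exp (-φ * y) * W y) (θ := θ - φ) (F := w)
    (sub_pos.2 hθ) (by rwa [h1]) (by rwa [h1])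
  rwa [h2] at h3

/-- The Laplace transform of `y ↦ (e^{φy} - 1) / φ - y`. -/
theorem laplace_exp_sub_affine {φ θ : ℝ} (hφ : 0 < φ) (hθ : φ < θ) :
    IntegrableOn (fun y => exp (-θ * y) * ((exp (φ * y) - 1) / φ - y)) (Ioi 0) ∧
      ∫ y in Ioi (0 : ℝ), exp (-θ * y) * ((exp (φ * y) - 1) / φ - y) =
        φ / (θ ^ 2 * (θ - φ)) := by
  have hθ0 : 0 < θ := hφ.trans hθ
  have hθφ : 0 < θ - φ := sub_pos.2 hθ
  have hone : ∀ {a : ℝ}, 0 < a → IntegrableOn (fun y => exp (-a * y)) (Ioi 0) ∧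
      ∫ y in Ioi (0 : ℝ), exp (-a * y) = 1 / a := by
    intro a ha
    refine ⟨exp_neg_integrableOn_Ioi 0 ha, ?_⟩
    rw [integral_exp_mul_Ioi (by linarith)]
    simp
  obtain ⟨i1, v1⟩ := hone hθφ
  obtain ⟨i2, v2⟩ := hone hθ0
  have h3 := laplace_primitive (f := fun _ => 1) (θ := θ) (F := 1 / θ) hθ0
    (by simpa using i2) (by simpa using v2)
  simp only [intervalIntegral.integral_const, sub_zero, smul_eq_mul, mul_one] at h3
  obtain ⟨i3, v3⟩ := h3
  have key : (fun y => exp (-θ * y) * ((exp (φ * y) - 1) / φ - y)) = fun y =>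
      (exp (-(θ - φ) * y) - exp (-θ * y)) / φ - exp (-θ * y) * y := by
    ext y
    have : exp (-(θ - φ) * y) = exp (-θ * y) * exp (φ * y) := by
      rw [← Real.exp_add]; ring_nf
    rw [this]; ring
  have i12 : IntegrableOn (fun y => (exp (-(θ - φ) * y) - exp (-θ * y)) / φ) (Ioi 0) :=
    (i1.sub i2).div_const φ
  rw [key]
  refine ⟨i12.sub i3, ?_⟩
  rw [integral_sub i12 i3, integral_div, integral_sub i1 i2, v1, v2, v3]
  field_simp
  ring

/-- The Laplace exponent grows at least linearly. -/
theorem mul_levyPsi_le {γ σ : ℝ} {ν : Measure ℝ}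
    (hν : IntegrableOn (fun z => min 1 (z ^ 2)) (Ioi 0) ν) {φ θ : ℝ} (hφ : 0 < φ) (hθ : φ < θ) :
    θ / φ * levyPsi γ σ ν φ ≤ levyPsi γ σ ν θ := by
  have hθ0 : 0 < θ := hφ.trans hθ
  have hI : θ / φ * ∫ z in Ioi (0 : ℝ),
      (exp (-φ * z) - 1 + φ * indicator (Ioo (0 : ℝ) 1) id z) ∂ν ≤
      ∫ z in Ioi (0 : ℝ), (exp (-θ * z) - 1 + θ * indicator (Ioo (0 : ℝ) 1) id z) ∂ν := by
    rw [← integral_const_mul]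
    refine integral_mono ((integrableOn_exp_compensated hν hφ).const_mul _)
      (integrableOn_exp_compensated hν hθ0) fun z => ?_
    have hb := one_add_mul_self_le_rpow_one_add (s := exp (-φ * z) - 1)
      (by linarith [exp_pos (-φ * z)]) (show 1 ≤ θ / φ from (one_le_div hφ).2 hθ.le)
    rw [add_sub_cancel, ← Real.exp_mul] at hb
    have e1 : -φ * z * (θ / φ) = -θ * z := by field_simp
    have e2 : θ / φ * φ = θ := by field_simp
    rw [e1] at hb
    simp only
    linear_combination hb + (indicator (Ioo (0 : ℝ) 1) id z) * e2
  have hq : θ / φ * (σ ^ 2 / 2 * φ ^ 2) ≤ σ ^ 2 / 2 * θ ^ 2 := by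
    have : θ / φ * (σ ^ 2 / 2 * φ ^ 2) = σ ^ 2 / 2 * (θ * φ) := by field_simp
    rw [this]
    refine mul_le_mul_of_nonneg_left ?_ (by positivity)
    nlinarith
  have hl : θ / φ * (γ * φ) = γ * θ := by field_simp
  rw [levyPsi, levyPsi]
  linear_combination hI + hq + hl

/-- The potential of `y ↦ (e^{φy} - 1) / φ - y` under `W` solves the Poisson equation on the
positive half-line. -/
theorem generator_potential {γ σ : ℝ} {ν : Measure ℝ}
    (hν : IntegrableOn (fun z => min 1 (z ^ 2)) (Ioi 0) ν)
    {q φ : ℝ} {W : ℝ → ℝ} (hq : 0 < q) (hφ : 0 < φ) (hψ : q < levyPsi γ σ ν φ)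
    (hW : HasLaplaceAt φ W)
    (hWlap : ∀ θ : ℝ, 0 < θ → q < levyPsi γ σ ν θ →
      IntegrableOn (fun z => exp (-θ * z) * W z) (Ioi 0) ∧
      ∫ z in Ioi (0:ℝ), exp (-θ * z) * W z = 1 / (levyPsi γ σ ν θ - q))
    {y : ℝ} (hy : 0 < y) :
    γ * (expConv φ W y - Wbar W y) + σ ^ 2 / 2 * (φ * expConv φ W y) +
      (∫ z in Ioi (0 : ℝ), (potential φ W (y - z) - potential φ W y +
        (expConv φ W y - Wbar W y) * indicator (Ioo (0 : ℝ) 1) id z) ∂ν) -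
      q * potential φ W y = (exp (φ * y) - 1) / φ - y := by
  have hU := hW.isMonotoneSmooth_potential hφ
  have cE := hW.continuous_expConv
  have cW := hW.continuous_Wbar
  have cU := hU.continuous
  have cI := hU.continuous_integral_jump hν
  set I : ℝ → ℝ := fun y => ∫ z in Ioi (0 : ℝ), (potential φ W (y - z) - potential φ W y +
        (expConv φ W y - Wbar W y) * indicator (Ioo (0 : ℝ) 1) id z) ∂ν with hI
  have hlap : ∀ θ > φ, IntegrableOn (fun y => exp (-θ * y) *
        (γ * (expConv φ W y - Wbar W y) + σ ^ 2 / 2 * (φ * expConv φ W y) + I y -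
          q * potential φ W y - ((exp (φ * y) - 1) / φ - y))) (Ioi 0) ∧
      ∫ y in Ioi (0 : ℝ), exp (-θ * y) *
        (γ * (expConv φ W y - Wbar W y) + σ ^ 2 / 2 * (φ * expConv φ W y) + I y -
          q * potential φ W y - ((exp (φ * y) - 1) / φ - y)) = 0 := by
    intro θ hθ
    have hθ0 : 0 < θ := hφ.trans hθ
    have hθφ : 0 < θ - φ := sub_pos.2 hθ
    have hψθ : q < levyPsi γ σ ν θ := by
      refine lt_of_lt_of_le ?_ (mul_levyPsi_le hν hφ hθ)
      have : 1 ≤ θ / φ := (one_le_div hφ).2 hθ.le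
      nlinarith
    obtain ⟨iW, vW⟩ := hWlap θ hθ0 hψθ
    set w := 1 / (levyPsi γ σ ν θ - q) with hw
    have hwψ : (levyPsi γ σ ν θ - q) * w = 1 := mul_one_div_cancel (sub_pos.2 hψθ).ne'
    obtain ⟨iE, vE⟩ := laplace_expConv hθ iW vW
    obtain ⟨iB, vB⟩ := laplace_primitive hθ0 iW vW
    obtain ⟨iBB, vBB⟩ := laplace_primitive hθ0 iB vB
    obtain ⟨iP, vP⟩ := laplace_exp_sub_affine hφ hθ
    change IntegrableOn (fun y => exp (-θ * y) * Wbar W y) (Ioi 0) at iB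
    change ∫ y in Ioi (0 : ℝ), exp (-θ * y) * Wbar W y = _ at vB
    change IntegrableOn (fun y => exp (-θ * y) * ∫ z in (0 : ℝ)..y, Wbar W z) (Ioi 0) at iBB
    change ∫ y in Ioi (0 : ℝ), exp (-θ * y) * ∫ z in (0 : ℝ)..y, Wbar W z = _ at vBB
    have i1 : IntegrableOn (fun y => exp (-θ * y) * (expConv φ W y - Wbar W y)) (Ioi 0) := by
      simp_rw [mul_sub]; exact iE.sub iB
    have v1 : ∫ y in Ioi (0 : ℝ), exp (-θ * y) * (expConv φ W y - Wbar W y) =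
        w / (θ - φ) - w / θ := by
      simp_rw [mul_sub]; rw [integral_sub iE iB, vE, vB]
    have e0 : (fun y => exp (-θ * y) * potential φ W y) = fun y =>
        exp (-θ * y) * (expConv φ W y - Wbar W y) / φ -
          exp (-θ * y) * ∫ z in (0 : ℝ)..y, Wbar W z := by
      ext y; rw [potential]; ring
    have i0 : IntegrableOn (fun y => exp (-θ * y) * potential φ W y) (Ioi 0) := by
      rw [e0]; exact (i1.div_const φ).sub iBB
    have v0 : ∫ y in Ioi (0 : ℝ), exp (-θ * y) * potential φ W y =
        w * (φ / (θ ^ 2 * (θ - φ))) := by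
      rw [e0, integral_sub (i1.div_const φ) iBB, integral_div, v1, vBB]
      field_simp
      ring
    have i2 : IntegrableOn (fun y => exp (-θ * y) * (φ * expConv φ W y)) (Ioi 0) := by
      simp_rw [mul_left_comm _ φ]; exact iE.const_mul φ
    have v2 : ∫ y in Ioi (0 : ℝ), exp (-θ * y) * (φ * expConv φ W y) = φ * (w / (θ - φ)) := by
      simp_rw [mul_left_comm _ φ]; rw [integral_const_mul, vE]
    obtain ⟨iI, vI⟩ := hU.laplace_integral_jump hν i0 i1 i2 v0 (by rw [v1]; field_simp; ring)
    change IntegrableOn (fun y => exp (-θ * y) * I y) (Ioi 0) at iI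
    change ∫ y in Ioi (0 : ℝ), exp (-θ * y) * I y = _ at vI
    have e : (fun y => exp (-θ * y) *
        (γ * (expConv φ W y - Wbar W y) + σ ^ 2 / 2 * (φ * expConv φ W y) + I y -
          q * potential φ W y - ((exp (φ * y) - 1) / φ - y))) = fun y =>
        γ * (exp (-θ * y) * (expConv φ W y - Wbar W y)) +
          σ ^ 2 / 2 * (exp (-θ * y) * (φ * expConv φ W y)) + exp (-θ * y) * I y -
          q * (exp (-θ * y) * potential φ W y) -
          exp (-θ * y) * ((exp (φ * y) - 1) / φ - y) := by
      ext y; ring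
    have j1 := i1.const_mul γ
    have j2 := i2.const_mul (σ ^ 2 / 2)
    have j0 := i0.const_mul q
    have j12 : IntegrableOn (fun y => γ * (exp (-θ * y) * (expConv φ W y - Wbar W y)) +
          σ ^ 2 / 2 * (exp (-θ * y) * (φ * expConv φ W y))) (Ioi 0) := j1.add j2
    have j12I : IntegrableOn (fun y => γ * (exp (-θ * y) * (expConv φ W y - Wbar W y)) +
          σ ^ 2 / 2 * (exp (-θ * y) * (φ * expConv φ W y)) + exp (-θ * y) * I y) (Ioi 0) :=
      j12.add iI
    have j : IntegrableOn (fun y => γ * (exp (-θ * y) * (expConv φ W y - Wbar W y)) +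
          σ ^ 2 / 2 * (exp (-θ * y) * (φ * expConv φ W y)) + exp (-θ * y) * I y -
          q * (exp (-θ * y) * potential φ W y)) (Ioi 0) := j12I.sub j0
    rw [e]
    refine ⟨j.sub iP, ?_⟩
    rw [integral_sub j iP, integral_sub j12I j0, integral_add j12 iI, integral_add j1 j2,
      integral_const_mul, integral_const_mul, integral_const_mul, v1, v2, vI, v0, vP]
    rw [levyPsi] at hwψ
    have h1 : w / (θ - φ) - w / θ = θ * (w * (φ / (θ ^ 2 * (θ - φ)))) := by
      field_simp; ring
    have h2 : φ * (w / (θ - φ)) = θ ^ 2 * (w * (φ / (θ ^ 2 * (θ - φ)))) := by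
      field_simp
    rw [h1, h2]
    linear_combination (φ / (θ ^ 2 * (θ - φ))) * hwψ
  have := eq_zero_of_laplace_eq_zero (θ₀ := φ) (D := fun y =>
    γ * (expConv φ W y - Wbar W y) + σ ^ 2 / 2 * (φ * expConv φ W y) + I y -
      q * potential φ W y - ((exp (φ * y) - 1) / φ - y)) (by fun_prop)
    (fun θ hθ => (hlap θ hθ).1) (fun θ hθ => (hlap θ hθ).2) y hy
  exact sub_eq_zero.1 this

theorem integral_sub_indicator {ν : Measure ℝ}
    (hν1 : IntegrableOn (fun z => z) (Ici 1) ν) :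
    IntegrableOn (fun z => z - indicator (Ioo (0 : ℝ) 1) id z) (Ioi 0) ν ∧
      ∫ z in Ioi (0 : ℝ), (z - indicator (Ioo (0 : ℝ) 1) id z) ∂ν = ∫ z in Ici (1 : ℝ), z ∂ν := by
  have heq : EqOn (indicator (Ici (1 : ℝ)) fun z => z)
      (fun z => z - indicator (Ioo (0 : ℝ) 1) id z) (Ioi 0) := by
    intro z hz
    rcases lt_or_ge z 1 with h | h
    · have h1 : z ∈ Ioo (0 : ℝ) 1 := ⟨hz, h⟩
      have h2 : z ∉ Ici (1 : ℝ) := not_le.2 h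
      simp [indicator_of_mem h1, indicator_of_notMem h2]
    · have h1 : z ∉ Ioo (0 : ℝ) 1 := fun h' => absurd h'.2 (not_lt.2 h)
      have h2 : z ∈ Ici (1 : ℝ) := h
      simp [indicator_of_notMem h1, indicator_of_mem h2]
  constructor
  · exact ((integrable_indicator_iff measurableSet_Ici).2 hν1).integrableOn.congr_fun heq
      measurableSet_Ioi
  · rw [← setIntegral_congr_fun measurableSet_Ioi heq, setIntegral_indicator measurableSet_Ici,
      inter_eq_self_of_subset_right (Ici_subset_Ioi.2 one_pos)]

/-- the smooth-fit form v(x) = −(r/(r+q))(Zbar(b−x)+m/q) − Zqr(b−x)/φ with b > 0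
satisfies the HJB equation of the periodic dividend problem: for every x > 0 and l ∈ [0,x],
(ℒ − q)v(x) + r(l + v(x−l) − v(x)) ≤ 0, with equality at l = max(x − b, 0). -/
theorem hjb_periodic_barrier
    (γ σ : ℝ) (hσ : 0 ≤ σ) (ν : MeasureTheory.Measure ℝ)
    (hν : MeasureTheory.IntegrableOn (fun z => min 1 (z ^ 2)) (Set.Ioi 0) ν)
    (hν1 : MeasureTheory.IntegrableOn (fun z => z) (Set.Ici 1) ν)
    (m : ℝ) (hm : m = γ - ∫ z in Set.Ici (1:ℝ), z ∂ν)
    (q r φ : ℝ) (hq : 0 < q) (hr : 0 < r) (hφ : 0 < φ)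
    (hψφ : levyPsi γ σ ν φ = q + r)
    (W : ℝ → ℝ)
    (hWneg : ∀ x < (0:ℝ), W x = 0)
    (hWnn : ∀ x : ℝ, 0 ≤ W x)
    (hWcont : ContinuousOn W (Set.Ioi 0))
    (hWmono : StrictMonoOn W (Set.Ioi 0))
    (hWrc : ∃ W0 : ℝ, Filter.Tendsto W (nhdsWithin 0 (Set.Ioi 0)) (nhds W0))
    (hWlap : ∀ θ : ℝ, 0 < θ → q < levyPsi γ σ ν θ →
      MeasureTheory.IntegrableOn (fun z => Real.exp (-θ * z) * W z) (Set.Ioi 0) ∧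
      ∫ z in Set.Ioi (0:ℝ), Real.exp (-θ * z) * W z = 1 / (levyPsi γ σ ν θ - q))
    (b : ℝ) (hb : 0 < b)
    (v : ℝ → ℝ)
    (hv : ∀ x : ℝ, v x = -(r / (r + q)) * (Zbar q W (b - x) + m / q) - Zqr q r φ W (b - x) / φ)
    : ∀ x : ℝ, 0 < x →
        (∀ l : ℝ, l ∈ Set.Icc 0 x →
          levyGen γ σ ν v x - q * v x + r * (l + v (x - l) - v x) ≤ 0) ∧
        levyGen γ σ ν v x - q * v x +
          r * (max (x - b) 0 + v (x - max (x - b) 0) - v x) = 0 := by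
  have hrq : 0 < r + q := by linarith
  have hψq : q < levyPsi γ σ ν φ := by linarith
  obtain ⟨hWi, hWv⟩ := hWlap φ hφ hψq
  have hW : HasLaplaceAt φ W := ⟨hWneg, hWnn, hWcont, hWi⟩
  have hU := hW.isMonotoneSmooth_potential hφ
  have hE := hW.hasDerivAt_expConv_sub_Wbar
  have hvU : ∀ x, v x = -(r / (r + q)) * (b - x + m / q + 1 / φ) -
      q / (r + q) / φ * exp (φ * (b - x)) + q * r / (r + q) * potential φ W (b - x) := by
    intro x
    have hZbar : Zbar q W (b - x) = (b - x) + q * ∫ z in (0 : ℝ)..(b - x), Wbar W z := by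
      unfold Zbar Zq
      rw [intervalIntegral.integral_add (by simp)
        ((hW.continuous_Wbar.const_mul q).intervalIntegrable _ _),
        intervalIntegral.integral_const_mul]
      simp
    rw [hv, hZbar, Zqr, Zq, Jfun, potential, expConv]
    field_simp
    ring
  have hexp : ∀ x, HasDerivAt (fun x => exp (φ * (b - x))) (-φ * exp (φ * (b - x))) x := by
    intro x
    refine ((((hasDerivAt_id x).const_sub b).const_mul φ).exp).congr_deriv ?_
    simp only [id]
    ring
  set V : ℝ → ℝ := fun x => r / (r + q) + q / (r + q) * exp (φ * (b - x)) -
    q * r / (r + q) * (expConv φ W (b - x) - Wbar W (b - x)) with hV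
  have hv1 : ∀ x, HasDerivAt v (V x) x := by
    intro x
    have h0 : HasDerivAt (fun x => b - x + m / q + 1 / φ) (-1) x :=
      (((hasDerivAt_id x).const_sub b).add_const _).add_const _
    have h1 := (hU.hasDerivAt (b - x)).comp x ((hasDerivAt_id x).const_sub b)
    have h2 := ((h0.const_mul (-(r / (r + q)))).sub
      ((hexp x).const_mul (q / (r + q) / φ))).add (h1.const_mul (q * r / (r + q)))
    rw [funext hvU]
    refine h2.congr_deriv ?_
    rw [hV]
    field_simp
    ring
  have hv2 : ∀ x, HasDerivAt V
      (-(q * φ / (r + q)) * (exp (φ * (b - x)) - r * expConv φ W (b - x))) x := by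
    intro x
    have h1 := (hE (b - x)).comp x ((hasDerivAt_id x).const_sub b)
    have h2 := (((hexp x).const_mul (q / (r + q))).const_add (r / (r + q))).sub
      (h1.const_mul (q * r / (r + q)))
    refine h2.congr_deriv ?_
    field_simp
    ring
  have hV_anti : Antitone V := by
    refine antitone_of_hasDerivAt_nonpos hv2 fun x => ?_
    have h1 := hW.expConv_le (b - x)
    rw [hWv, hψφ, add_sub_cancel_left, mul_one_div, le_div_iff₀ hr] at h1
    rw [neg_mul]
    exact neg_nonpos.2 (mul_nonneg (by positivity) (by linarith))
  have hVb : V b = 1 := by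
    simp only [hV, sub_self, mul_zero, Real.exp_zero, hW.expConv_eq_zero le_rfl,
      hW.Wbar_eq_zero le_rfl]
    field_simp
    ring
  have hN : ∀ x, HasDerivAt (fun x => v x - x) (V x - 1) x := fun x =>
    (hv1 x).sub (hasDerivAt_id x)
  have hNc : Continuous fun x => v x - x :=
    continuous_iff_continuousAt.2 fun x => (hN x).continuousAt
  have hN_mono : MonotoneOn (fun x => v x - x) (Iic b) := by
    refine monotoneOn_of_hasDerivWithinAt_nonneg (convex_Iic b) hNc.continuousOn
      (fun x _ => (hN x).hasDerivWithinAt) fun x hx => ?_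
    have := hV_anti (interior_subset hx : x ∈ Iic b)
    linarith
  have hN_anti : AntitoneOn (fun x => v x - x) (Ici b) := by
    refine antitoneOn_of_hasDerivWithinAt_nonpos (convex_Ici b) hNc.continuousOn
      (fun x _ => (hN x).hasDerivWithinAt) fun x hx => ?_
    have := hV_anti (interior_subset hx : x ∈ Ici b)
    linarith
  have hgen : ∀ x, levyGen γ σ ν v x = -γ * V x + σ ^ 2 / 2 *
      (-(q * φ / (r + q)) * (exp (φ * (b - x)) - r * expConv φ W (b - x))) +
      (r / (r + q) * (γ - m) - q / (r + q) / φ * exp (φ * (b - x)) *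
        (q + r - γ * φ - σ ^ 2 / 2 * φ ^ 2) + q * r / (r + q) *
        ∫ z in Ioi (0 : ℝ), (potential φ W (b - x - z) - potential φ W (b - x) +
          (expConv φ W (b - x) - Wbar W (b - x)) * indicator (Ioo (0 : ℝ) 1) id z) ∂ν) := by
    intro x
    have hd : deriv v = V := funext fun x => (hv1 x).deriv
    rw [levyGen, hd, (hv2 x).deriv]
    congr 1
    obtain ⟨i1, e1⟩ := integral_sub_indicator hν1
    have i2 := integrableOn_exp_compensated hν hφ
    have i3 := hU.integrableOn_jump hν (b - x)
    have e2 : ∫ z in Ioi (0 : ℝ), (exp (-φ * z) - 1 + φ * indicator (Ioo (0 : ℝ) 1) id z) ∂ν =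
        q + r - γ * φ - σ ^ 2 / 2 * φ ^ 2 := by
      rw [levyPsi] at hψφ
      linarith
    have e3 : γ - m = ∫ z in Ici (1 : ℝ), z ∂ν := by rw [hm]; ring
    rw [← e2, e3, ← e1, ← integral_const_mul, ← integral_const_mul, ← integral_const_mul]
    have j1 := i1.const_mul (r / (r + q))
    have j2 := i2.const_mul (q / (r + q) / φ * exp (φ * (b - x)))
    have j3 := i3.const_mul (q * r / (r + q))
    have j12 := j1.sub j2
    rw [← integral_sub j1 j2]
    refine Eq.trans ?_ (integral_add j12 j3)
    refine setIntegral_congr_fun measurableSet_Ioi fun z _ => ?_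
    have hz : exp (φ * (b - x - z)) = exp (φ * (b - x)) * exp (-φ * z) := by
      rw [← Real.exp_add]; ring_nf
    simp only [hvU, hV, show b - (x + z) = b - x - z by ring, hz]
    generalize exp (φ * (b - x)) = A
    generalize exp (-φ * z) = B
    field_simp
    ring
  intro x hx
  have heq : levyGen γ σ ν v x - q * v x +
      r * (max (x - b) 0 + v (x - max (x - b) 0) - v x) = 0 := by
    rcases lt_or_ge x b with hxb | hxb
    · have key := generator_potential (σ := σ) hν hq hφ hψq hW hWlap (sub_pos.2 hxb)
      rw [max_eq_right (by linarith), sub_zero, hgen, hvU, hV]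
      set I := ∫ z in Ioi (0 : ℝ), (potential φ W (b - x - z) - potential φ W (b - x) +
          (expConv φ W (b - x) - Wbar W (b - x)) * indicator (Ioo (0 : ℝ) 1) id z) ∂ν
      have hI : I = (exp (φ * (b - x)) - 1) / φ - (b - x) + q * potential φ W (b - x) -
          γ * (expConv φ W (b - x) - Wbar W (b - x)) -
          σ ^ 2 / 2 * (φ * expConv φ W (b - x)) := by linarith
      rw [hI]
      field_simp
      ring
    · have hy : b - x ≤ 0 := by linarith
      have hI : ∫ z in Ioi (0 : ℝ), (potential φ W (b - x - z) - potential φ W (b - x) +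
          (expConv φ W (b - x) - Wbar W (b - x)) * indicator (Ioo (0 : ℝ) 1) id z) ∂ν = 0 := by
        refine setIntegral_eq_zero_of_forall_eq_zero fun z hz => ?_
        have hz : 0 < z := hz
        rw [hU.eq_zero _ hy, hU.eq_zero (b - x - z) (by linarith), hU.eq_zero' _ hy]
        simp
      rw [max_eq_left (by linarith), sub_sub_cancel, hgen, hI, hvU, hvU, hV]
      simp only [hU.eq_zero _ hy, hW.expConv_eq_zero hy, hW.Wbar_eq_zero hy, sub_self, mul_zero,
        Real.exp_zero, hU.eq_zero 0 le_rfl]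
      field_simp
      ring
  refine ⟨fun l hl => ?_, heq⟩
  have hopt : l + v (x - l) ≤ max (x - b) 0 + v (x - max (x - b) 0) := by
    have hl0 := hl.1
    rcases lt_or_ge x b with hxb | hxb
    · rw [max_eq_right (by linarith), sub_zero]
      have := hN_mono (show x - l ∈ Iic b from by simp only [mem_Iic]; linarith)
        (show x ∈ Iic b from hxb.le) (by linarith)
      simp only at this
      linarith
    · rw [max_eq_left (by linarith), sub_sub_cancel]
      have : v (x - l) - (x - l) ≤ v b - b := by
        rcases le_total (x - l) b with h | h
        · exact hN_mono h self_mem_Iic h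
        · exact hN_anti self_mem_Ici h h
      linarith
  have := mul_le_mul_of_nonneg_left hopt hr.le
  linarith
end

section
/- Assume ∫_{[1,∞)} z Π(dz) < ∞, set m := γ − ∫_{[1,∞)} z Π(dz), let q, r > 0, let φ > 0 satisfy ψ(φ) = q + r, and let ρ ∈ ℝ satisfy m ≥ −(q/r)·(q+r)·(ρ + 1/φ). Define v_0(x) := (r/(r+q))·[ x − (m/(r+q) − ρ) + (m/(r+q) + qρ/r)·e^{−φx} ] for x ∈ ℝ. Then for every x > 0 and every l ∈ [0, x], (ℒ − q)v_0(x) + r·( l + v_0(x−l) − v_0(x) ) ≤ 0, and equality holds for l = x. -/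
open MeasureTheory Real Set Filter Topology

theorem exp_neg_le_one_sub_add_sq {u : ℝ} (hu : 0 ≤ u) : exp (-u) ≤ 1 - u + u ^ 2 := by
  have h1 : exp (-u) * (1 + u) ≤ 1 := by
    have h := mul_le_mul_of_nonneg_left (add_one_le_exp u) (exp_pos (-u)).le
    rw [← exp_add, neg_add_cancel, exp_zero] at h
    linarith
  refine le_of_mul_le_mul_right (h1.trans ?_) (by linarith : 0 < 1 + u)
  nlinarith [pow_nonneg hu 3]

theorem integrableOn_levyPsi_integrand {ν : Measure ℝ} {θ : ℝ} (hθ : 0 ≤ θ)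
    (hν : IntegrableOn (fun z => min 1 (z ^ 2)) (Ioi 0) ν) :
    IntegrableOn (fun z => exp (-θ * z) - 1 + θ * indicator (Ioo (0:ℝ) 1) id z) (Ioi 0) ν := by
  refine Integrable.mono' (hν.const_mul (1 + θ ^ 2)) ?_ ?_
  · exact (((by fun_prop : Measurable fun z : ℝ => exp (-θ * z) - 1)).add
      ((measurable_id.indicator measurableSet_Ioo).const_mul θ)).aestronglyMeasurable
  · refine (ae_restrict_iff' measurableSet_Ioi).2 (Eventually.of_forall fun z hz => ?_)
    have hz : 0 < z := hz
    have hu : 0 ≤ θ * z := by positivity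
    rw [norm_eq_abs, abs_le, neg_mul]
    have he := exp_pos (-(θ * z))
    by_cases h : z < 1
    · rw [indicator_of_mem (show z ∈ Ioo (0:ℝ) 1 from ⟨hz, h⟩), id, min_eq_right (by nlinarith)]
      have h1 := exp_neg_le_one_sub_add_sq hu
      have h2 := add_one_le_exp (-(θ * z))
      constructor <;> nlinarith [sq_nonneg (θ * z), sq_nonneg z]
    · rw [indicator_of_notMem (fun hz' => h hz'.2), min_eq_left (by nlinarith)]
      have h1 : exp (-(θ * z)) ≤ 1 := exp_le_one_iff.2 (by linarith)
      constructor <;> nlinarith [sq_nonneg θ]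

/-- The generator acts on `x ↦ a + b * x + c * exp (-θ * x)` through the drift and `levyPsi`. -/
theorem levyGen_affine_add_exp (γ σ : ℝ) {ν : Measure ℝ} {θ : ℝ} (hθ : 0 ≤ θ)
    (hν : IntegrableOn (fun z => min 1 (z ^ 2)) (Ioi 0) ν)
    (hν1 : IntegrableOn (fun z => z) (Ici 1) ν) (a b c x : ℝ) :
    levyGen γ σ ν (fun y => a + b * y + c * exp (-θ * y)) x =
      -b * (γ - ∫ z in Ici (1:ℝ), z ∂ν) + c * exp (-θ * x) * levyPsi γ σ ν θ := by
  have hE : ∀ y : ℝ, HasDerivAt (fun y => exp (-θ * y)) (-θ * exp (-θ * y)) y := fun y => by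
    simpa [mul_comm] using ((hasDerivAt_id y).const_mul (-θ)).exp
  have hd : deriv (fun y => a + b * y + c * exp (-θ * y)) =
      fun y => b + c * (-θ * exp (-θ * y)) := by
    ext y
    have h : HasDerivAt (fun y => a + b * y + c * exp (-θ * y))
        (b * 1 + c * (-θ * exp (-θ * y))) y :=
      (((hasDerivAt_id y).const_mul b).const_add a).add ((hE y).const_mul c)
    rw [h.deriv, mul_one]
  have hdd : deriv (fun y => b + c * (-θ * exp (-θ * y))) x = c * (θ ^ 2 * exp (-θ * x)) := by
    rw [((((hE x).const_mul (-θ)).const_mul c).const_add b).deriv]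
    ring
  have hsub : Ioi (0:ℝ) ∩ Ici 1 = Ici 1 :=
    inter_eq_right.2 fun z hz => lt_of_lt_of_le (one_pos (α := ℝ)) hz
  have hJ : IntegrableOn (indicator (Ici (1:ℝ)) fun z => z) (Ioi 0) ν :=
    ((integrable_indicator_iff measurableSet_Ici).2 hν1).integrableOn
  have hI : ∫ z in Ioi (0:ℝ), ((a + b * (x + z) + c * exp (-θ * (x + z)))
        - (a + b * x + c * exp (-θ * x))
        - (b + c * (-θ * exp (-θ * x))) * indicator (Ioo (0:ℝ) 1) id z) ∂ν =
      b * (∫ z in Ici (1:ℝ), z ∂ν) + c * exp (-θ * x) *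
        ∫ z in Ioi (0:ℝ), (exp (-θ * z) - 1 + θ * indicator (Ioo (0:ℝ) 1) id z) ∂ν := by
    have h1 : ∫ z in Ici (1:ℝ), z ∂ν = ∫ z in Ioi (0:ℝ), indicator (Ici (1:ℝ)) (fun z => z) z ∂ν := by
      rw [setIntegral_indicator measurableSet_Ici, hsub]
    rw [h1, ← integral_const_mul, ← integral_const_mul,
      ← integral_add (hJ.const_mul b) ((integrableOn_levyPsi_integrand hθ hν).const_mul _)]
    refine setIntegral_congr_fun measurableSet_Ioi fun z hz => ?_
    have hz : 0 < z := hz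
    have he : exp (-θ * (x + z)) = exp (-θ * x) * exp (-θ * z) := by rw [← exp_add]; ring_nf
    simp only [he]
    by_cases h : z < 1
    · rw [indicator_of_mem (show z ∈ Ioo (0:ℝ) 1 from ⟨hz, h⟩),
        indicator_of_notMem (show z ∉ Ici (1:ℝ) from not_le.2 h), id]
      ring
    · rw [indicator_of_notMem (fun hz' => h hz'.2),
        indicator_of_mem (show z ∈ Ici (1:ℝ) from not_lt.1 h)]
      ring
  simp only [levyGen, levyPsi, hd, hdd, hI]
  ring

/-- under m ≥ −(q/r)(q+r)(ρ + 1/φ), the take-the-money-and-run value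
v₀(x) = (r/(r+q))·[x − (m/(r+q) − ρ) + (m/(r+q) + qρ/r)·e^{−φx}] satisfies the HJB inequality
(ℒ − q)v₀(x) + r(l + v₀(x−l) − v₀(x)) ≤ 0 for all x > 0 and l ∈ [0,x], with equality at l = x. -/
theorem hjb_barrier_zero
    (γ σ : ℝ) (hσ : 0 ≤ σ) (ν : MeasureTheory.Measure ℝ)
    (hν : MeasureTheory.IntegrableOn (fun z => min 1 (z ^ 2)) (Set.Ioi 0) ν)
    (hν1 : MeasureTheory.IntegrableOn (fun z => z) (Set.Ici 1) ν)
    (m : ℝ) (hm : m = γ - ∫ z in Set.Ici (1:ℝ), z ∂ν)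
    (q r φ ρ : ℝ) (hq : 0 < q) (hr : 0 < r) (hφ : 0 < φ)
    (hψ : levyPsi γ σ ν φ = q + r)
    (hcrit : m ≥ -(q / r) * (q + r) * (ρ + 1 / φ))
    (v₀ : ℝ → ℝ)
    (hv₀ : ∀ x : ℝ, v₀ x =
      r / (r + q) * (x - (m / (r + q) - ρ) + (m / (r + q) + q * ρ / r) * Real.exp (-φ * x)))
    : ∀ x : ℝ, 0 < x →
        (∀ l : ℝ, l ∈ Set.Icc 0 x →
          levyGen γ σ ν v₀ x - q * v₀ x + r * (l + v₀ (x - l) - v₀ x) ≤ 0) ∧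
        levyGen γ σ ν v₀ x - q * v₀ x + r * (x + v₀ 0 - v₀ x) = 0 := by
  have hv : v₀ = fun y => -(r / (r + q) * (m / (r + q) - ρ)) + r / (r + q) * y +
      r / (r + q) * (m / (r + q) + q * ρ / r) * exp (-φ * y) := by
    ext y
    rw [hv₀]
    ring
  intro x _
  have hL : levyGen γ σ ν v₀ x = -(r / (r + q)) * m +
      r / (r + q) * (m / (r + q) + q * ρ / r) * exp (-φ * x) * (q + r) := by
    rw [hv, levyGen_affine_add_exp γ σ hφ.le hν hν1, hψ, ← hm]
  have heq : levyGen γ σ ν v₀ x - q * v₀ x + r * (x + v₀ 0 - v₀ x) = 0 := by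
    rw [hL, hv₀ x, hv₀ 0, mul_zero, exp_zero]
    field_simp
    ring
  refine ⟨fun l hl => ?_, heq⟩
  have hkey : v₀ (x - l) - (x - l) ≤ v₀ 0 := by
    have hy : 0 ≤ x - l := by linarith [hl.2]
    generalize x - l = y at hy
    have hB : -(q / (r * φ)) ≤ m / (r + q) + q * ρ / r := by
      have h : m / (r + q) + q * ρ / r + q / (r * φ) =
          (m - -(q / r) * (q + r) * (ρ + 1 / φ)) / (r + q) := by
        field_simp
        ring
      have : 0 ≤ (m - -(q / r) * (q + r) * (ρ + 1 / φ)) / (r + q) :=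
        div_nonneg (by linarith) (by linarith)
      linarith
    have he0 : 0 ≤ 1 - exp (-φ * y) := by
      have : exp (-φ * y) ≤ 1 := exp_le_one_iff.2 (by nlinarith)
      linarith
    have he1 : 1 - exp (-φ * y) ≤ φ * y := by linarith [add_one_le_exp (-φ * y)]
    have h1 := mul_le_mul_of_nonneg_right hB he0
    have h2 := mul_le_mul_of_nonneg_left he1 (by positivity : 0 ≤ q / (r * φ))
    have h3 : q / (r * φ) * (φ * y) = q / r * y := by field_simp
    have h4 : 0 ≤ r / (r + q) *
        (q / r * y + (m / (r + q) + q * ρ / r) * (1 - exp (-φ * y))) :=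
      mul_nonneg (by positivity) (by linarith)
    have h5 : r / (r + q) * (q / r * y) = y - r / (r + q) * y := by
      field_simp
      ring
    rw [hv₀ y, hv₀ 0, mul_zero, exp_zero]
    linarith
  have := mul_le_mul_of_nonneg_left hkey hr.le
  linarith
end

section
/- Let β > 1, let b† > 0 be the unique solution of Zqr(b†) = β, fix m ∈ ℝ, and define u(x) := −(r/(r+q))·(Zbar(b†−x) + m/q) − Zqr(b†−x)/φ for x ∈ ℝ. Then u is differentiable with u′(x) = Zqr(b†−x) for every x; consequently u is strictly increasing and strictly concave on (0,∞), u′(b†) = 1, u′(0) = β, and u′(x) ≤ β for every x ≥ 0. -/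
open MeasureTheory Real Set Filter Topology

section helpers

variable {q r φ : ℝ} {W : ℝ → ℝ}

theorem integrable_exp_mul_of_Ioi (hWneg : ∀ x < (0:ℝ), W x = 0)
    (hWint : IntegrableOn (fun z => Real.exp (-φ * z) * W z) (Set.Ioi 0)) :
    Integrable (fun z => Real.exp (-φ * z) * W z) := by
  have h1 : IntegrableOn (fun z => Real.exp (-φ * z) * W z) (Set.Iio 0) := by
    refine (integrableOn_zero (μ := volume) (s := Set.Iio (0:ℝ)) (ε' := ℝ)).congr_fun ?_
      measurableSet_Iio
    intro x hx
    simp [hWneg x hx]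
  have h2 : IntegrableOn (fun z => Real.exp (-φ * z) * W z) (Set.Iic 0) :=
    (integrableOn_Iic_iff_integrableOn_Iio (by simp)).mpr h1
  rw [← integrableOn_univ, ← Set.Iic_union_Ioi (a := (0:ℝ))]
  exact h2.union hWint

theorem eq_exp_mul_exp_neg_mul (φ : ℝ) (W : ℝ → ℝ) :
    W = fun z => Real.exp (φ * z) * (Real.exp (-φ * z) * W z) := by
  funext z
  rw [← mul_assoc, ← Real.exp_add]
  simp

theorem intervalIntegrable_of_exp_mul
    (hf : Integrable (fun z => Real.exp (-φ * z) * W z)) (a b : ℝ) :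
    IntervalIntegrable W volume a b := by
  rw [eq_exp_mul_exp_neg_mul φ W]
  exact hf.intervalIntegrable.continuousOn_mul (by fun_prop)

theorem aestronglyMeasurable_of_exp_mul
    (hf : Integrable (fun z => Real.exp (-φ * z) * W z)) :
    AEStronglyMeasurable W volume := by
  rw [eq_exp_mul_exp_neg_mul φ W]
  exact (Continuous.aestronglyMeasurable (by fun_prop)).mul hf.aestronglyMeasurable

theorem continuous_Zq (hf : Integrable (fun z => Real.exp (-φ * z) * W z)) :
    Continuous (Zq q W) := by
  have := intervalIntegral.continuous_primitive (intervalIntegrable_of_exp_mul hf) 0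
  unfold Zq Wbar
  fun_prop

theorem continuous_Jfun (hf : Integrable (fun z => Real.exp (-φ * z) * W z)) :
    Continuous (Jfun r φ W) := by
  have := intervalIntegral.continuous_primitive (fun a b => hf.intervalIntegrable (a := a) (b := b)) 0
  unfold Jfun
  fun_prop

theorem continuousAt_of_ne_zero (hWneg : ∀ x < (0:ℝ), W x = 0)
    (hWcont : ContinuousOn W (Set.Ioi 0)) {x : ℝ} (hx : x ≠ 0) : ContinuousAt W x := by
  rcases lt_or_gt_of_ne hx with h | h
  · have : W =ᶠ[𝓝 x] fun _ => 0 := by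
      filter_upwards [Iio_mem_nhds h] with y hy using hWneg y hy
    exact continuousAt_const.congr this.symm
  · exact hWcont.continuousAt (Ioi_mem_nhds h)

theorem hasDerivAt_Zbar (hf : Integrable (fun z => Real.exp (-φ * z) * W z)) (x : ℝ) :
    HasDerivAt (Zbar q W) (Zq q W x) x :=
  (continuous_Zq hf).integral_hasStrictDerivAt 0 x |>.hasDerivAt

theorem hasDerivAt_Zqr_of_continuousAt (hq : 0 < q) (hr : 0 < r)
    (hf : Integrable (fun z => Real.exp (-φ * z) * W z)) {x : ℝ} (hx : ContinuousAt W x) :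
    HasDerivAt (Zqr q r φ W) (q * φ / (r + q) * Jfun r φ W x) x := by
  have h1 : HasDerivAt (fun x => ∫ z in (0:ℝ)..x, W z) (W x) x :=
    intervalIntegral.integral_hasDerivAt_right (intervalIntegrable_of_exp_mul hf _ _)
      (aestronglyMeasurable_of_exp_mul hf).stronglyMeasurableAtFilter hx
  have h2 : HasDerivAt (fun x => ∫ z in (0:ℝ)..x, Real.exp (-φ * z) * W z)
      (Real.exp (-φ * x) * W x) x :=
    intervalIntegral.integral_hasDerivAt_right hf.intervalIntegrable
      hf.aestronglyMeasurable.stronglyMeasurableAtFilter (by fun_prop)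
  have h3 : HasDerivAt (fun x => Real.exp (φ * x)) (Real.exp (φ * x) * φ) x := by
    simpa using ((hasDerivAt_id x).const_mul φ).exp
  have h4 := (((h1.const_mul q).const_add 1).const_mul (r / (r + q))).add
    ((h3.mul ((h2.const_mul r).const_sub 1)).const_mul (q / (r + q)))
  refine h4.congr_deriv ?_
  have he : Real.exp (φ * x) * Real.exp (-φ * x) = 1 := by
    rw [← Real.exp_add]; simp
  rw [neg_mul] at he
  have : r + q ≠ 0 := by positivity
  unfold Jfun
  field_simp
  linear_combination (-W x * r) * he

theorem continuous_Zqr (hf : Integrable (fun z => Real.exp (-φ * z) * W z)) :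
    Continuous (Zqr q r φ W) := by
  have h1 := continuous_Zq (q := q) hf
  have h2 := continuous_Jfun (r := r) hf
  unfold Zqr
  fun_prop

/-- The jump of `W` at `0` cancels in the derivative of `Zqr`. -/
theorem hasDerivAt_Zqr (hq : 0 < q) (hr : 0 < r) (hWneg : ∀ x < (0:ℝ), W x = 0)
    (hWcont : ContinuousOn W (Set.Ioi 0))
    (hf : Integrable (fun z => Real.exp (-φ * z) * W z)) (x : ℝ) :
    HasDerivAt (Zqr q r φ W) (q * φ / (r + q) * Jfun r φ W x) x := by
  have key : ∀ y ≠ (0:ℝ), HasDerivAt (Zqr q r φ W) (q * φ / (r + q) * Jfun r φ W y) y :=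
    fun y hy => hasDerivAt_Zqr_of_continuousAt hq hr hf (continuousAt_of_ne_zero hWneg hWcont hy)
  rcases eq_or_ne x 0 with rfl | hx
  · exact hasDerivAt_of_hasDerivAt_of_ne key (continuous_Zqr hf).continuousAt
      ((continuous_Jfun hf).const_mul _).continuousAt
  · exact key x hx

theorem Jfun_pos (hr : 0 < r) (hWnn : ∀ x : ℝ, 0 ≤ W x) (hWmono : StrictMonoOn W (Set.Ioi 0))
    (hf : Integrable (fun z => Real.exp (-φ * z) * W z))
    (hWlap : r * ∫ z in Set.Ioi (0:ℝ), Real.exp (-φ * z) * W z = 1) (x : ℝ) :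
    0 < Jfun r φ W x := by
  have hWpos : ∀ y > (0:ℝ), 0 < W y := fun y hy =>
    (hWnn (y / 2)).trans_lt (hWmono (half_pos hy) hy (half_lt_self hy))
  have hsplit := intervalIntegral.integral_interval_add_Ioi
    (hf.integrableOn (s := Set.Ioi (0:ℝ))) (hf.integrableOn (s := Set.Ioi x))
  have htail : 0 < ∫ z in Set.Ioi x, Real.exp (-φ * z) * W z := by
    rw [setIntegral_pos_iff_support_of_nonneg_ae
      (Eventually.of_forall fun z => mul_nonneg (Real.exp_pos _).le (hWnn z)) hf.integrableOn]
    have hsub : Set.Ioi (max x 0) ⊆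
        Function.support (fun z => Real.exp (-φ * z) * W z) ∩ Set.Ioi x := by
      intro z hz
      obtain ⟨h1, h2⟩ := max_lt_iff.mp (Set.mem_Ioi.mp hz)
      exact ⟨(mul_pos (Real.exp_pos _) (hWpos z h2)).ne', h1⟩
    exact lt_of_lt_of_le (by simp) (measure_mono hsub)
  refine mul_pos (Real.exp_pos _) ?_
  rw [← hsplit] at hWlap
  nlinarith [mul_pos hr htail]

theorem one_le_Zq (hq : 0 < q) (hWneg : ∀ x < (0:ℝ), W x = 0) (hWnn : ∀ x : ℝ, 0 ≤ W x)
    (x : ℝ) : 1 ≤ Zq q W x := by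
  have h : 0 ≤ Wbar W x := by
    rcases le_total 0 x with hx | hx
    · exact intervalIntegral.integral_nonneg hx fun z _ => hWnn z
    · unfold Wbar
      rw [intervalIntegral.integral_symm, intervalIntegral.integral_of_le hx,
        integral_Ioc_eq_integral_Ioo, setIntegral_congr_fun measurableSet_Ioo
          (g := fun _ => (0:ℝ)) fun z hz => hWneg z hz.2]
      simp
  have := mul_nonneg hq.le h
  unfold Zq
  linarith

theorem Zqr_zero (hq : 0 < q) (hr : 0 < r) : Zqr q r φ W 0 = 1 := by
  have : r + q ≠ 0 := by positivity
  simp only [Zqr, Zq, Wbar, Jfun, intervalIntegral.integral_same]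
  field_simp
  simp

end helpers

/-- for β > 1 and b† > 0 the (unique) solution of Zqr(b†) = β, the function
u(x) = −(r/(r+q))(Zbar(b†−x)+m/q) − Zqr(b†−x)/φ satisfies u′(x) = Zqr(b†−x) for all x; u is
strictly increasing and strictly concave on (0,∞), u′(b†) = 1, u′(0) = β, and u′(x) ≤ β for x ≥ 0. -/
theorem bailout_value_function_properties
    (q r φ : ℝ) (W : ℝ → ℝ)
    (hq : 0 < q) (hr : 0 < r) (hφ : 0 < φ)
    (hWneg : ∀ x < (0:ℝ), W x = 0)
    (hWnn : ∀ x : ℝ, 0 ≤ W x)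
    (hWcont : ContinuousOn W (Set.Ioi 0))
    (hWmono : StrictMonoOn W (Set.Ioi 0))
    (W0 : ℝ)
    (hW0 : Filter.Tendsto W (nhdsWithin 0 (Set.Ioi 0)) (nhds W0))
    (hWint : MeasureTheory.IntegrableOn (fun z => Real.exp (-φ * z) * W z) (Set.Ioi 0))
    (hWlap : r * ∫ z in Set.Ioi (0:ℝ), Real.exp (-φ * z) * W z = 1)
    (β : ℝ) (hβ : 1 < β)
    (bd : ℝ) (hbd : 0 < bd) (hbdroot : Zqr q r φ W bd = β)
    (m : ℝ)
    (u : ℝ → ℝ)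
    (hu : ∀ x : ℝ, u x = -(r / (r + q)) * (Zbar q W (bd - x) + m / q) - Zqr q r φ W (bd - x) / φ)
    : (∀ x : ℝ, HasDerivAt u (Zqr q r φ W (bd - x)) x) ∧
      StrictMonoOn u (Set.Ioi 0) ∧ StrictConcaveOn ℝ (Set.Ioi 0) u ∧
      HasDerivAt u 1 bd ∧
      HasDerivAt u β 0 ∧
      (∀ x : ℝ, 0 ≤ x → Zqr q r φ W (bd - x) ≤ β) := by
  have hf := integrable_exp_mul_of_Ioi hWneg hWint
  have hJpos := Jfun_pos hr hWnn hWmono hf hWlap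
  have hdZ := hasDerivAt_Zqr hq hr hWneg hWcont hf
  have hZmono : StrictMono (Zqr q r φ W) := by
    refine strictMono_of_deriv_pos fun x => ?_
    rw [(hdZ x).deriv]
    have := hJpos x
    positivity
  have hZpos : ∀ x, 0 < Zqr q r φ W x := fun x => by
    have h1 := one_le_Zq hq hWneg hWnn x
    have h2 := hJpos x
    unfold Zqr
    positivity
  have hdu : ∀ x, HasDerivAt u (Zqr q r φ W (bd - x)) x := by
    intro x
    have h1 : HasDerivAt (fun x => bd - x) (-1) x := (hasDerivAt_id x).const_sub bd
    have h2 := (hasDerivAt_Zbar (q := q) hf (bd - x)).comp x h1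
    have h3 := (hdZ (bd - x)).comp x h1
    have h4 := ((h2.add_const (m / q)).const_mul (-(r / (r + q)))).sub (h3.div_const φ)
    rw [show u = _ from funext hu]
    refine h4.congr_deriv ?_
    have : r + q ≠ 0 := by positivity
    unfold Zqr
    field_simp
    ring
  have hderiv : deriv u = fun x => Zqr q r φ W (bd - x) := funext fun x => (hdu x).deriv
  have hcont : Continuous u := continuous_iff_continuousAt.mpr fun x => (hdu x).continuousAt
  refine ⟨hdu, ?_, ?_, ?_, ?_, ?_⟩
  · refine (strictMono_of_deriv_pos fun x => ?_).strictMonoOn _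
    rw [hderiv]
    exact hZpos _
  · refine StrictAntiOn.strictConcaveOn_of_deriv (convex_Ioi 0) hcont.continuousOn ?_
    rw [hderiv]
    exact fun x _ y _ hxy => hZmono (by linarith)
  · simpa [Zqr_zero hq hr] using hdu bd
  · simpa [hbdroot] using hdu 0
  · intro x hx
    rw [← hbdroot]
    exact hZmono.monotone (by linarith)
end
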